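/- arXiv:1903.04338 — 2 statements merged into one kernel-verified Lean document; each statement's English description precedes it below -/
import Mathlib

section
/- Let Γ ⊆ [0, ∞) be a set of nonnegative real numbers. The following are equivalent: (1) for every finite subset Γ₀ ⊆ Γ there exist a nonnegative integer c and real numbers r₁, …, r_c such that 1, r₁, …, r_c are linearly independent over ℚ and every element of Γ₀ belongs to Span_{ℚ≥0}({1, r₁, …, r_c}); (2) Span_{ℚ≥0}(Γ \ ℚ) ∩ (ℚ \ {0}) = ∅. -/
/-- `Span_{ℚ≥0}(S)`: all finite sums `λ₁s₁ + … + λ_r s_r` with `r ≥ 1`, each `λᵢ` a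
nonnegative rational and each `sᵢ ∈ S`. -/
def qnnSpan (S : Set ℝ) : Set ℝ :=
  {x | ∃ (r : ℕ), 0 < r ∧ ∃ (l : Fin r → ℚ) (s : Fin r → ℝ),
    (∀ i, 0 ≤ l i) ∧ (∀ i, s i ∈ S) ∧ x = ∑ i, (l i : ℝ) * s i}

/-- Membership in the span of `1, r₁, …, r_c`, in coordinates. -/
lemma mem_qnnSpan_iff_coords {c : ℕ} (r : Fin c → ℝ) (x : ℝ) :
    x ∈ qnnSpan (insert 1 (Set.range r)) ↔
      ∃ (a : ℚ) (b : Fin c → ℚ), 0 ≤ a ∧ (∀ j, 0 ≤ b j) ∧ x = (a : ℝ) + ∑ j, (b j : ℝ) * r j := by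
  constructor
  · rintro ⟨m, -, l, s, hl, hs, rfl⟩
    have key : ∀ i, ∃ (a : ℚ) (b : Fin c → ℚ), 0 ≤ a ∧ (∀ j, 0 ≤ b j) ∧
        s i = (a : ℝ) + ∑ j, (b j : ℝ) * r j := by
      intro i
      rcases hs i with h | ⟨j, h⟩
      · exact ⟨1, 0, by norm_num, by simp, by simp [h]⟩
      · refine ⟨0, fun k => if k = j then 1 else 0, le_rfl, ?_, ?_⟩
        · intro k
          dsimp only
          split_ifs <;> norm_num
        · rw [← h, Finset.sum_eq_single j]
          · simp
          · intro k _ hk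
            simp [hk]
          · simp
    choose A B hA hB hAB using key
    refine ⟨∑ i, l i * A i, fun j => ∑ i, l i * B i j,
      Finset.sum_nonneg fun i _ => mul_nonneg (hl i) (hA i),
      fun j => Finset.sum_nonneg fun i _ => mul_nonneg (hl i) (hB i j), ?_⟩
    push_cast
    simp_rw [Finset.sum_mul]
    rw [Finset.sum_comm, ← Finset.sum_add_distrib]
    refine Finset.sum_congr rfl fun i _ => ?_
    rw [hAB i, mul_add, Finset.mul_sum]
    simp_rw [mul_assoc]
  · rintro ⟨a, b, ha, hb, rfl⟩
    refine ⟨c + 1, Nat.succ_pos _, Fin.cons a b, Fin.cons 1 r, ?_, ?_, ?_⟩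
    · intro i
      refine Fin.cases ?_ (fun j => ?_) i
      · simpa using ha
      · simpa using hb j
    · intro i
      refine Fin.cases ?_ (fun j => ?_) i
      · simp
      · simp
    · simp [Fin.sum_univ_succ]

/-- Lifting a simplicial cone from the quotient by a line. -/
lemma lift_cone {V : Type} [AddCommGroup V] [Module ℚ V] (e : V) (he : e ≠ 0) {n : ℕ}
    (v : Fin n → V) {c : ℕ} (w : Fin c → V ⧸ (Submodule.span ℚ {e}))
    (hw : LinearIndependent ℚ w)
    (hv0 : ∀ i, (Submodule.span ℚ {e}).mkQ (v i) ≠ 0)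
    (hv : ∀ i, ∃ b : Fin c → ℚ, (∀ j, 0 ≤ b j) ∧
      (Submodule.span ℚ {e}).mkQ (v i) = ∑ j, b j • w j) :
    ∃ w' : Fin c → V,
      (∀ (q₀ : ℚ) (q : Fin c → ℚ), q₀ • e + ∑ j, q j • w' j = 0 → q₀ = 0 ∧ ∀ j, q j = 0) ∧
      ∀ i, ∃ (a : ℚ) (b : Fin c → ℚ), 0 ≤ a ∧ (∀ j, 0 ≤ b j) ∧
        v i = a • e + ∑ j, b j • w' j := by
  choose b hb hvb using hv
  choose u hu using fun j => (Submodule.span ℚ {e}).mkQ_surjective (w j)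
  have hpos : ∀ i, 0 < ∑ j, b i j := by
    intro i
    refine lt_of_le_of_ne (Finset.sum_nonneg fun j _ => hb i j) fun h => hv0 i ?_
    have h' := (Finset.sum_eq_zero_iff_of_nonneg fun j _ => hb i j).1 h.symm
    rw [hvb i]
    exact Finset.sum_eq_zero fun j hj => by rw [h' j hj, zero_smul]
  have hA : ∀ i, ∃ a : ℚ, a • e = v i - ∑ j, b i j • u j := by
    intro i
    rw [← Submodule.mem_span_singleton, ← Submodule.Quotient.mk_eq_zero, ← Submodule.mkQ_apply,
      map_sub, map_sum, hvb i]
    simp [map_smul, hu, -Submodule.mkQ_apply]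
  choose a ha using hA
  obtain ⟨N, hN⟩ := Finite.exists_le fun i => (-a i) / ∑ j, b i j
  have hme : (Submodule.span ℚ {e}).mkQ e = 0 := by
    rw [Submodule.mkQ_apply, Submodule.Quotient.mk_eq_zero]
    exact Submodule.mem_span_singleton_self e
  refine ⟨fun j => u j - N • e, ?_, ?_⟩
  · intro q₀ q h
    have h1 := congrArg (Submodule.span ℚ {e}).mkQ h
    simp only [map_add, map_sum, map_smul, map_sub, hme, hu, smul_zero, sub_zero, zero_add,
      map_zero] at h1
    have h2 := Fintype.linearIndependent_iff.1 hw q h1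
    refine ⟨?_, h2⟩
    simp only [h2, zero_smul, Finset.sum_const_zero, add_zero] at h
    exact (smul_eq_zero.1 h).resolve_right he
  · intro i
    refine ⟨a i + N * ∑ j, b i j, b i, ?_, hb i, ?_⟩
    · have := (div_le_iff₀ (hpos i)).1 (hN i)
      linarith
    · simp only [smul_sub, Finset.sum_sub_distrib, smul_smul, ← Finset.sum_smul,
        ← Finset.sum_mul]
      rw [add_smul, ha i, mul_comm N]
      abel

/-- A finite family without nontrivial nonnegative relations lies in a simplicial cone. -/
lemma exists_simplicial_cone : ∀ (n : ℕ) (V : Type) [AddCommGroup V] [Module ℚ V] (v : Fin n → V),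
    (∀ l : Fin n → ℚ, (∀ i, 0 ≤ l i) → ∑ i, l i • v i = 0 → ∀ i, l i = 0) →
    ∃ (c : ℕ) (w : Fin c → V), LinearIndependent ℚ w ∧
      ∀ i, ∃ b : Fin c → ℚ, (∀ j, 0 ≤ b j) ∧ v i = ∑ j, b j • w j := by
  intro n
  induction n with
  | zero =>
    intro V _ _ v _
    exact ⟨0, Fin.elim0, linearIndependent_empty_type, fun i => i.elim0⟩
  | succ n ih =>
    intro V _ _ v h
    have cons_nonneg : ∀ (t : ℚ) (l : Fin n → ℚ), 0 ≤ t → (∀ i, 0 ≤ l i) →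
        ∀ i, 0 ≤ (Fin.cons t l : Fin (n + 1) → ℚ) i := by
      intro t l ht hl i
      refine Fin.cases ?_ (fun j => ?_) i
      · simpa using ht
      · simpa using hl j
    have hc : ∀ (t : ℚ) (l : Fin n → ℚ), 0 ≤ t → (∀ i, 0 ≤ l i) →
        t • v 0 + ∑ i, l i • v i.succ = 0 → t = 0 ∧ ∀ i, l i = 0 := by
      intro t l ht hl hs
      have := h (Fin.cons t l) (cons_nonneg t l ht hl) (by simpa [Fin.sum_univ_succ] using hs)
      exact ⟨by simpa using this 0, fun i => by simpa using this i.succ⟩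
    by_cases hA : ∃ l : Fin n → ℚ, (∀ i, 0 ≤ l i) ∧ v 0 = ∑ i, l i • v i.succ
    · obtain ⟨l, hl, hl0⟩ := hA
      obtain ⟨c, w, hw, hvw⟩ := ih V (fun i => v i.succ)
        fun l hl hs => (hc 0 l le_rfl hl (by simpa using hs)).2
      choose b hb hvb using hvw
      refine ⟨c, w, hw, fun i => ?_⟩
      refine Fin.cases ?_ (fun j => ?_) i
      · refine ⟨fun j => ∑ i, l i * b i j,
          fun j => Finset.sum_nonneg fun i _ => mul_nonneg (hl i) (hb i j), ?_⟩
        rw [hl0]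
        simp_rw [Finset.sum_smul]
        rw [Finset.sum_comm]
        refine Finset.sum_congr rfl fun i _ => ?_
        rw [hvb i, Finset.smul_sum]
        simp_rw [smul_smul]
      · exact ⟨b j, hb j, hvb j⟩
    · have he : v 0 ≠ 0 := by
        intro h0
        have := (hc 1 0 zero_le_one (by simp) (by simp [h0])).1
        norm_num at this
      have hq : ∀ l : Fin n → ℚ, (∀ i, 0 ≤ l i) →
          ∑ i, l i • (Submodule.span ℚ {v 0}).mkQ (v i.succ) = 0 → ∀ i, l i = 0 := by
        intro l hl hs
        have h1 : (Submodule.span ℚ {v 0}).mkQ (∑ i, l i • v i.succ) = 0 := by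
          rw [map_sum]; simpa only [map_smul] using hs
        rw [Submodule.mkQ_apply, Submodule.Quotient.mk_eq_zero,
          Submodule.mem_span_singleton] at h1
        obtain ⟨t, ht⟩ := h1
        rcases le_or_gt t 0 with h0 | h0
        · exact (hc (-t) l (by linarith) hl (by rw [← ht, neg_smul]; abel)).2
        · refine absurd ⟨fun i => t⁻¹ * l i, fun i => mul_nonneg (inv_nonneg.2 h0.le) (hl i), ?_⟩ hA
          simp_rw [mul_smul, ← Finset.smul_sum]
          rw [← ht, smul_smul, inv_mul_cancel₀ h0.ne', one_smul]
      obtain ⟨c, w, hw, hvw⟩ := ih _ (fun i => (Submodule.span ℚ {v 0}).mkQ (v i.succ)) hq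
      have hne : ∀ i : Fin n, (Submodule.span ℚ {v 0}).mkQ (v i.succ) ≠ 0 := by
        intro i h0
        have := hq (fun k => if k = i then 1 else 0)
          (fun k => by split_ifs <;> norm_num)
          (by simpa [-Submodule.mkQ_apply] using h0) i
        simp at this
      obtain ⟨w', hw', hvw'⟩ := lift_cone (v 0) he (fun i => v i.succ) w hw hne hvw
      refine ⟨c + 1, Fin.cons (v 0) w', ?_, fun i => ?_⟩
      · rw [Fintype.linearIndependent_iff]
        intro g hg i
        have := hw' (g 0) (fun j => g j.succ) (by simpa [Fin.sum_univ_succ] using hg)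
        exact Fin.cases this.1 this.2 i
      · refine Fin.cases ?_ (fun j => ?_) i
        · refine ⟨Fin.cons 1 0, ?_, by simp [Fin.sum_univ_succ]⟩
          intro j
          refine Fin.cases ?_ (fun k => ?_) j <;> simp
        · obtain ⟨a, b, ha, hb, hab⟩ := hvw' j
          refine ⟨Fin.cons a b, ?_, by simpa [Fin.sum_univ_succ] using hab⟩
          intro k
          refine Fin.cases ?_ (fun k => ?_) k
          · simpa using ha
          · simpa using hb k

/-- Lemma 6.5 (`lem:finitesetmonotonic`): for a set `Γ` of nonnegative reals, the following are
equivalent: (1) every finite subset of `Γ` lies in `Span_{ℚ≥0}({1, r₁, …, r_c})` for some reals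
with `1, r₁, …, r_c` linearly independent over `ℚ`; (2)
`Span_{ℚ≥0}(Γ \ ℚ) ∩ (ℚ \ {0}) = ∅`. -/
theorem stmt_4 (Γ : Set ℝ) (hΓ : ∀ x ∈ Γ, 0 ≤ x) :
    (∀ Γ₀ : Finset ℝ, ↑Γ₀ ⊆ Γ →
      ∃ (c : ℕ) (r : Fin c → ℝ),
        (∀ (q₀ : ℚ) (q : Fin c → ℚ),
          (q₀ : ℝ) + ∑ i, (q i : ℝ) * r i = 0 → q₀ = 0 ∧ ∀ i, q i = 0) ∧
        (∀ x ∈ Γ₀, x ∈ qnnSpan (insert 1 (Set.range r)))) ↔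
    qnnSpan (Γ \ Set.range ((↑) : ℚ → ℝ)) ∩ (Set.range ((↑) : ℚ → ℝ) \ {0}) = ∅ := by
  classical
  constructor
  · intro H
    rw [Set.eq_empty_iff_forall_notMem]
    rintro x ⟨⟨m, -, l, s, hl, hs, hx⟩, ⟨q, hq⟩, hx0⟩
    obtain ⟨c, r, hind, hr⟩ := H (Finset.univ.image s) (by
      intro y hy
      simp only [Finset.coe_image, Finset.coe_univ, Set.image_univ, Set.mem_range] at hy
      obtain ⟨i, rfl⟩ := hy
      exact (hs i).1)
    have key := fun i => (mem_qnnSpan_iff_coords r (s i)).1 (hr (s i) (by simp))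
    choose A B hA hB hAB using key
    have hsum : ((∑ i, l i * A i - q : ℚ) : ℝ) +
        ∑ j, ((∑ i, l i * B i j : ℚ) : ℝ) * r j = 0 := by
      have : (q : ℝ) = ((∑ i, l i * A i : ℚ) : ℝ) +
          ∑ j, ((∑ i, l i * B i j : ℚ) : ℝ) * r j := by
        rw [hq, hx]
        push_cast
        simp_rw [Finset.sum_mul]
        rw [Finset.sum_comm, ← Finset.sum_add_distrib]
        refine Finset.sum_congr rfl fun i _ => ?_
        rw [hAB i, mul_add, Finset.mul_sum]
        simp_rw [mul_assoc]
      rw [Rat.cast_sub]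
      linarith
    have hz := (hind _ _ hsum).2
    have hl0 : ∀ i, l i = 0 := by
      intro i
      by_contra hne
      refine (hs i).2 ⟨A i, ?_⟩
      have : ∀ j, B i j = 0 := by
        intro j
        have := (Finset.sum_eq_zero_iff_of_nonneg
          fun i _ => mul_nonneg (hl i) (hB i j)).1 (hz j) i (Finset.mem_univ i)
        exact (mul_eq_zero.1 this).resolve_left hne
      rw [hAB i]
      simp [this]
    exact hx0 (by simp [hx, hl0])
  · intro H Γ₀ hΓ₀
    set T := Γ₀.filter fun x => x ∉ Set.range ((↑) : ℚ → ℝ) with hT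
    let s : Fin T.card → ℝ := fun i => (T.equivFin.symm i : ℝ)
    have hsT : ∀ i, s i ∈ T := fun i => (T.equivFin.symm i).2
    have hsΓ : ∀ i, s i ∈ Γ \ Set.range ((↑) : ℚ → ℝ) := fun i =>
      ⟨hΓ₀ (Finset.mem_filter.1 (hsT i)).1, (Finset.mem_filter.1 (hsT i)).2⟩
    have hspos : ∀ i, 0 < s i := fun i =>
      lt_of_le_of_ne (hΓ _ (hsΓ i).1) fun h => (hsΓ i).2 ⟨0, by rw [← h]; simp⟩
    have hq : ∀ l : Fin T.card → ℚ, (∀ i, 0 ≤ l i) →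
        ∑ i, l i • (Submodule.span ℚ {(1 : ℝ)}).mkQ (s i) = 0 → ∀ i, l i = 0 := by
      intro l hl hs i
      have h1 : (Submodule.span ℚ {(1 : ℝ)}).mkQ (∑ i, l i • s i) = 0 := by
        rw [map_sum]; simpa only [map_smul] using hs
      rw [Submodule.mkQ_apply, Submodule.Quotient.mk_eq_zero,
        Submodule.mem_span_singleton] at h1
      obtain ⟨t, ht⟩ := h1
      simp only [Rat.smul_def, mul_one] at ht
      have h0 : ∑ i, (l i : ℝ) * s i = 0 := by
        by_contra hne
        have : ∑ i, (l i : ℝ) * s i ∈ (∅ : Set ℝ) := by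
          rw [← H]
          exact ⟨⟨T.card, i.pos, l, s, hl, hsΓ, rfl⟩, ⟨t, ht⟩, hne⟩
        exact this
      have h2 := (Finset.sum_eq_zero_iff_of_nonneg fun i _ =>
        mul_nonneg (Rat.cast_nonneg.2 (hl i)) (hspos i).le).1 h0 i (Finset.mem_univ i)
      exact_mod_cast (mul_eq_zero.1 h2).resolve_right (hspos i).ne'
    obtain ⟨c, w, hw, hvw⟩ := exists_simplicial_cone _ _ _ hq
    have hne : ∀ i, (Submodule.span ℚ {(1 : ℝ)}).mkQ (s i) ≠ 0 := by
      intro i h0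
      rw [Submodule.mkQ_apply, Submodule.Quotient.mk_eq_zero,
        Submodule.mem_span_singleton] at h0
      obtain ⟨t, ht⟩ := h0
      exact (hsΓ i).2 ⟨t, by simpa [Rat.smul_def] using ht⟩
    obtain ⟨r, hr, hsr⟩ := lift_cone (1 : ℝ) one_ne_zero s w hw hne hvw
    simp only [Rat.smul_def, mul_one] at hr hsr
    refine ⟨c, r, hr, fun x hx => (mem_qnnSpan_iff_coords r x).2 ?_⟩
    by_cases hxq : x ∈ Set.range ((↑) : ℚ → ℝ)
    · obtain ⟨t, rfl⟩ := hxq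
      exact ⟨t, 0, by exact_mod_cast hΓ _ (hΓ₀ hx), by simp, by simp⟩
    · have hxT : x ∈ T := Finset.mem_filter.2 ⟨hx, hxq⟩
      have := hsr (T.equivFin ⟨x, hxT⟩)
      simpa [s] using this
end

section
/- Let p₀, s, k be positive integers, ε₀ > 0 a real number, ‖·‖ a norm on ℝˢ, and ‖·‖∞ the maximum norm. Let a = (a₁, …, a_k) ∈ ℝᵏ with every aᵢ > 0 and a₁ + … + a_k = 1, and let v ∈ ℝˢ be a point with v ∉ ℚˢ. Let V ⊆ ℝˢ be the rational envelope of v and let e be a nonzero vector in the direction of V. Then there exist a positive integer n₀, a point v' ∈ V, and a vector a' = (a₁', …, a_k') with every aᵢ' > 0, such that: (1) p₀ divides n₀; (2) a₁' + … + a_k' = 1; (3) n₀·v' ∈ ℤˢ and n₀·aᵢ' ∈ ℤ for every i; (4) ‖v − v'‖ < ε₀/n₀ and ‖a − a'‖∞ < ε₀/n₀; and (5) ‖ (v − v')/‖v − v'‖ − e/‖e‖ ‖ < ε₀ (note that v ≠ v', since n₀·v' ∈ ℤˢ forces v' ∈ ℚˢ while v ∉ ℚˢ). -/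
/-- A point of `ℝˢ` with all rational coordinates. -/
def IsRationalPoint {s : ℕ} (x : Fin s → ℝ) : Prop := ∀ i, ∃ q : ℚ, x i = (q : ℝ)

/-- An affine subspace of `ℝˢ` is defined over `ℚ` if it equals the affine span of its
rational points. -/
def IsRationalAffine {s : ℕ} (W : AffineSubspace ℝ (Fin s → ℝ)) : Prop :=
  (W : Set (Fin s → ℝ)) = ↑(affineSpan ℝ {x : Fin s → ℝ | x ∈ W ∧ IsRationalPoint x})

section
open Filter Topology

lemma aux_mean (w : ℂ) (hw : ‖w‖ = 1) (hw1 : w ≠ 1) :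
    Tendsto (fun N : ℕ => (∑ n ∈ Finset.range N, w ^ (n+1)) / (N : ℂ)) atTop (𝓝 0) := by
  rw [tendsto_zero_iff_norm_tendsto_zero]
  have hb : ∀ N : ℕ, ‖(∑ n ∈ Finset.range N, w ^ (n+1)) / (N : ℂ)‖ ≤ (2 / ‖w - 1‖) / (N : ℝ) := by
    intro N
    have h1 : ∑ n ∈ Finset.range N, w ^ (n+1) = w * ((w ^ N - 1) / (w - 1)) := by
      rw [← geom_sum_eq hw1, Finset.mul_sum]
      exact Finset.sum_congr rfl fun n _ => by ring
    rw [h1, norm_div, norm_mul, norm_div, hw, one_mul, Complex.norm_natCast]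
    gcongr
    calc ‖w ^ N - 1‖ ≤ ‖w ^ N‖ + ‖(1:ℂ)‖ := norm_sub_le _ _
      _ = 2 := by rw [norm_pow, hw]; norm_num
  refine squeeze_zero (fun _ => norm_nonneg _) hb ?_
  exact tendsto_const_div_atTop_nhds_zero_nat _

/-- the character -/
noncomputable def ee (x : ℝ) : ℂ := Complex.exp ((2 * Real.pi * x : ℝ) * Complex.I)

lemma ee_add (x y : ℝ) : ee (x + y) = ee x * ee y := by
  unfold ee; rw [← Complex.exp_add]; congr 1; push_cast; ring

lemma ee_zero : ee 0 = 1 := by simp [ee]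

lemma ee_norm (x : ℝ) : ‖ee x‖ = 1 := Complex.norm_exp_ofReal_mul_I _

lemma ee_nat_mul (n : ℕ) (x : ℝ) : ee (n * x) = ee x ^ n := by
  unfold ee; rw [← Complex.exp_nat_mul]; congr 1; push_cast; ring

lemma ee_sum {ι : Type*} (s : Finset ι) (f : ι → ℝ) : ee (∑ i ∈ s, f i) = ∏ i ∈ s, ee (f i) := by
  unfold ee; rw [← Complex.exp_sum]; congr 1; push_cast; rw [Finset.mul_sum, Finset.sum_mul]

lemma ee_eq_one {x : ℝ} (h : ee x = 1) : ∃ z : ℤ, x = z := by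
  unfold ee at h
  rw [Complex.exp_eq_one_iff] at h
  obtain ⟨z, hz⟩ := h
  refine ⟨z, ?_⟩
  have hpi : (Real.pi : ℂ) ≠ 0 := by exact_mod_cast Real.pi_ne_zero
  have h2 : (2 * Real.pi * Complex.I : ℂ) ≠ 0 := by simp [hpi]
  have : (x : ℂ) = z := by
    apply mul_right_cancel₀ h2
    rw [← hz]; push_cast; ring
  exact_mod_cast this

/-- kernel -/
noncomputable def fker (K : ℕ) (x : ℝ) : ℂ := (((1 + Real.cos (2 * Real.pi * x)) / 2 : ℝ) : ℂ) ^ K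

lemma ker_eq (K : ℕ) (x : ℝ) : fker K x =
    ∑ j ∈ Finset.range (2*K+1), ((2*K).choose j / 4 ^ K : ℂ) * ee (((j:ℝ) - K) * x) := by
  have h0 : (((1 + Real.cos (2 * Real.pi * x)) / 2 : ℝ) : ℂ) = ee (-x) * (ee x + 1)^2 / 4 := by
    have h1 : ee (-x) * ee x = 1 := by rw [← ee_add]; simp [ee_zero]
    have h2 : (((1 + Real.cos (2 * Real.pi * x)) / 2 : ℝ) : ℂ) = (2 + ee x + ee (-x)) / 4 := by
      unfold ee
      push_cast
      rw [Complex.cos]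
      rw [show -(2 * (Real.pi:ℂ) * x) * Complex.I = 2 * Real.pi * -x * Complex.I by ring]
      ring
    rw [h2]
    linear_combination (-1/4 * ee x - 1/2) * h1
  unfold fker
  rw [h0, div_pow, mul_pow, ← pow_mul, add_pow, Finset.mul_sum, Finset.sum_div]
  refine Finset.sum_congr rfl fun j _ => ?_
  have : ee (((j:ℝ) - K) * x) = ee (-x) ^ K * ee x ^ j := by
    rw [← ee_nat_mul, ← ee_nat_mul, ← ee_add]; congr 1; ring
  rw [this]; simp; ring

lemma ker_bound {K : ℕ} {x δ : ℝ} (hδ : 0 ≤ δ) (h : ∀ z : ℤ, δ ≤ |x - z|) :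
    ‖fker K x‖ ≤ ((1 + Real.cos (2 * Real.pi * δ)) / 2) ^ K := by
  unfold fker
  rw [norm_pow, Complex.norm_real, Real.norm_of_nonneg (by linarith [Real.neg_one_le_cos (2 * Real.pi * x)])]
  have hc : Real.cos (2 * Real.pi * x) ≤ Real.cos (2 * Real.pi * δ) := by
    have h1 : Real.cos (2 * Real.pi * x) = Real.cos (2 * Real.pi * |x - round x|) := by
      rw [show 2 * Real.pi * |x - round x| = |2 * Real.pi * x - (round x : ℤ) * (2 * Real.pi)| by
        rw [show 2 * Real.pi * x - (round x : ℤ) * (2 * Real.pi) = (2 * Real.pi) * (x - round x) by ring,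
          abs_mul, abs_of_pos Real.two_pi_pos]]
      rw [Real.cos_abs, Real.cos_sub_int_mul_two_pi]
    rw [h1]
    have := abs_sub_round x
    apply Real.cos_le_cos_of_nonneg_of_le_pi
    · have := Real.pi_pos; positivity
    · nlinarith [Real.pi_pos]
    · have := h (round x); have := Real.pi_pos; gcongr
  have := Real.neg_one_le_cos (2 * Real.pi * x)
  gcongr
  linarith

lemma kron_mean {ι : Type*} [Fintype ι] (b t : ι → ℝ)
    (hb : ∀ (c : ι → ℤ) (z : ℤ), ∑ i, (c i : ℝ) * b i = z → c = 0) (K : ℕ) :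
    Tendsto (fun N : ℕ => (∑ n ∈ Finset.range N, ∏ i, fker K (((n+1 : ℕ) : ℝ) * b i - t i)) / (N : ℂ))
      atTop (𝓝 (((2*K).choose K / 4 ^ K : ℂ) ^ Fintype.card ι)) := by
  classical
  set S := Fintype.piFinset (fun _ : ι => Finset.range (2*K+1)) with hS
  set A : (ι → ℕ) → ℂ := fun J => ∏ i, (((2*K).choose (J i) / 4 ^ K : ℂ) * ee (-(((J i:ℝ) - K) * t i))) with hA
  set θ : (ι → ℕ) → ℝ := fun J => ∑ i, ((J i:ℝ) - K) * b i with hθ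
  have h1 : ∀ n : ℕ, ∏ i, fker K ((n : ℝ) * b i - t i) = ∑ J ∈ S, A J * ee (θ J) ^ n := by
    intro n
    simp_rw [ker_eq]
    rw [Finset.prod_univ_sum]
    refine Finset.sum_congr rfl fun J _ => ?_
    simp only [hA, hθ]
    rw [← ee_nat_mul, Finset.mul_sum, ee_sum, ← Finset.prod_mul_distrib]
    refine Finset.prod_congr rfl fun i _ => ?_
    rw [mul_assoc, ← ee_add]
    congr 2; ring
  have h2 : (fun N : ℕ => (∑ n ∈ Finset.range N, ∏ i, fker K (((n+1 : ℕ) : ℝ) * b i - t i)) / (N : ℂ))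
      = fun N : ℕ => ∑ J ∈ S, A J * ((∑ n ∈ Finset.range N, ee (θ J) ^ (n+1)) / (N : ℂ)) := by
    funext N
    simp_rw [h1]
    rw [Finset.sum_comm, Finset.sum_div]
    refine Finset.sum_congr rfl fun J _ => ?_
    rw [← Finset.mul_sum, mul_div_assoc]
  rw [h2]
  have hK : (fun _ : ι => K) ∈ S := by simp [hS]; omega
  have h3 : (((2*K).choose K / 4 ^ K : ℂ) ^ Fintype.card ι)
      = ∑ J ∈ S, A J * (if J = (fun _ => K) then 1 else 0) := by
    simp [Finset.sum_ite_eq, hK, hA, ee_zero, div_pow]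
  rw [h3]
  refine tendsto_finsetSum _ fun J _ => Tendsto.const_mul _ ?_
  split_ifs with hJ
  · subst hJ
    have : ee (θ fun _ => K) = 1 := by simp [hθ, ee_zero]
    simp only [this, one_pow]
    refine tendsto_const_nhds.congr' ?_
    filter_upwards [eventually_gt_atTop 0] with N hN
    have : (N : ℂ) ≠ 0 := by exact_mod_cast hN.ne'
    simp [this]
  · refine aux_mean _ (ee_norm _) fun h => hJ ?_
    obtain ⟨z, hz⟩ := ee_eq_one h
    have := hb (fun i => (J i : ℤ) - K) z (by rw [← hz]; simp [hθ])
    funext i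
    have := congrFun this i
    simp at this; omega

lemma kronecker {ι : Type*} [Fintype ι] (b t : ι → ℝ)
    (hb : ∀ (c : ι → ℤ) (z : ℤ), ∑ i, (c i : ℝ) * b i = z → c = 0) (δ : ℝ) (hδ : 0 < δ) :
    ∃ n : ℕ, 0 < n ∧ ∃ z : ι → ℤ, ∀ i, |(n : ℝ) * b i - t i - z i| < δ := by
  by_contra hcon
  push Not at hcon
  wlog hδ2 : δ ≤ 1/2 generalizing δ
  · refine this (1/2) (by norm_num) ?_ le_rfl
    intro n hn z
    obtain ⟨i, hi⟩ := hcon n hn z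
    exact ⟨i, by linarith⟩
  set ρ := (1 + Real.cos (2 * Real.pi * δ)) / 2 with hρ
  have hρ0 : 0 ≤ ρ := by have := Real.neg_one_le_cos (2 * Real.pi * δ); rw [hρ]; linarith
  have hρ1 : ρ < 1 := by
    have : Real.cos (2 * Real.pi * δ) < Real.cos 0 := by
      apply Real.cos_lt_cos_of_nonneg_of_le_pi le_rfl
      · nlinarith [Real.pi_pos]
      · have := Real.pi_pos; positivity
    rw [Real.cos_zero] at this; rw [hρ]; linarith
  have hF : ∀ K n : ℕ, ‖∏ i, fker K (((n+1 : ℕ) : ℝ) * b i - t i)‖ ≤ ρ ^ K := by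
    intro K n
    have : ∃ i, ∀ z : ℤ, δ ≤ |((n+1 : ℕ) : ℝ) * b i - t i - z| := by
      by_contra h
      push Not at h
      choose z hz using h
      obtain ⟨i, hi⟩ := hcon (n+1) (by omega) z
      exact absurd (hz i) (not_lt.mpr hi)
    obtain ⟨i, hi⟩ := this
    classical
    rw [norm_prod, ← Finset.mul_prod_erase _ _ (Finset.mem_univ i)]
    calc _ ≤ ρ ^ K * 1 := by
          refine mul_le_mul (ker_bound hδ.le hi) ?_ (Finset.prod_nonneg fun _ _ => norm_nonneg _) (by positivity)
          refine Finset.prod_le_one (fun _ _ => norm_nonneg _) fun j _ => ?_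
          unfold fker
          rw [norm_pow, Complex.norm_real]
          apply pow_le_one₀ (norm_nonneg _)
          rw [Real.norm_eq_abs, abs_le]
          constructor <;> linarith [Real.neg_one_le_cos (2 * Real.pi * (((n+1 : ℕ) : ℝ) * b j - t j)), Real.cos_le_one (2 * Real.pi * (((n+1 : ℕ) : ℝ) * b j - t j))]
      _ = ρ ^ K := mul_one _
  have hA : ∀ K : ℕ, ((1:ℝ) / (2 * K + 1)) ^ Fintype.card ι ≤ ρ ^ K := by
    intro K
    have hle := le_of_tendsto (kron_mean b t hb K).norm (b := ρ ^ K) (by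
      filter_upwards [eventually_gt_atTop 0] with N hN
      have hN' : (0:ℝ) < N := by exact_mod_cast hN
      rw [norm_div, Complex.norm_natCast, div_le_iff₀ hN']
      refine (norm_sum_le _ _).trans ?_
      refine (Finset.sum_le_sum fun n _ => hF K n).trans ?_
      simp [mul_comm])
    refine le_trans ?_ hle
    rw [norm_pow]
    apply pow_le_pow_left₀ (by positivity)
    rw [norm_div, norm_pow, Complex.norm_natCast]
    have := Nat.four_pow_le_two_mul_add_one_mul_central_binom K
    have h4 : (4:ℝ) ^ K ≤ (2 * K + 1) * ((2*K).choose K : ℕ) := by exact_mod_cast this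
    rw [show ‖(4:ℂ)‖ = 4 by simp, div_le_div_iff₀ (by positivity) (by positivity)]
    linarith
  have hlim := (tendsto_pow_const_mul_const_pow_of_abs_lt_one (Fintype.card ι) (r := ρ) (by rw [abs_of_nonneg hρ0]; exact hρ1)).const_mul ((3:ℝ) ^ Fintype.card ι)
  rw [mul_zero] at hlim
  have := ge_of_tendsto hlim (b := 1) (by
    filter_upwards [eventually_ge_atTop 1] with K hK
    have hK' : (1:ℝ) ≤ K := by exact_mod_cast hK
    have h := hA K
    rw [one_div, inv_pow, inv_le_iff_one_le_mul₀ (by positivity)] at h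
    calc (1:ℝ) ≤ ρ ^ K * (2 * K + 1) ^ Fintype.card ι := h
      _ ≤ ρ ^ K * (3 * K) ^ Fintype.card ι := by gcongr; linarith
      _ = _ := by rw [mul_pow]; ring)
  linarith

end

lemma rat_family {J : Type*} [Fintype J] (f : J → ℝ) :
    ∃ (ι : Type) (_ : Fintype ι) (b : ι → ℝ) (c0 : J → ℚ) (c : J → ι → ℚ),
      (∀ x, f x = c0 x + ∑ i, (c x i : ℝ) * b i) ∧
      ∀ y : ι → ℝ, ∃ φ : ℝ →ₗ[ℚ] ℝ, φ 1 = 1 ∧ ∀ i, φ (b i) = y i := by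
  classical
  have h1 : LinearIndepOn ℚ id ({1} : Set ℝ) := by
    exact LinearIndepOn.singleton (R := ℚ) (v := id) (one_ne_zero (α := ℝ))
  let H := Module.Basis.extend h1
  obtain ⟨i0, hi0⟩ : ∃ i0, H i0 = 1 :=
    ⟨⟨1, Module.Basis.subset_extend h1 rfl⟩, Module.Basis.extend_apply_self h1 _⟩
  let F := (Finset.univ.biUnion fun x => (H.repr (f x)).support).erase i0
  refine ⟨F, inferInstance, fun i => H i, fun x => H.repr (f x) i0, fun x i => H.repr (f x) i, ?_, ?_⟩
  · intro x
    have hsub : (H.repr (f x)).support ⊆ insert i0 F := by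
      intro j hj
      by_cases hji : j = i0
      · simp [hji]
      · refine Finset.mem_insert_of_mem (Finset.mem_erase.mpr ⟨hji, Finset.mem_biUnion.mpr ⟨x, Finset.mem_univ _, hj⟩⟩)
    have h2 := H.linearCombination_repr (f x)
    rw [Finsupp.linearCombination_apply, Finsupp.sum_of_support_subset _ hsub _ (by simp),
      Finset.sum_insert (by simp [F]), hi0] at h2
    rw [Finset.sum_coe_sort F (fun i => ((H.repr (f x) i : ℚ) : ℝ) * H i)]
    conv_lhs => rw [← h2]
    simp [Rat.smul_def]
  · intro y
    refine ⟨H.constr ℚ (fun k => if hk : k ∈ F then y ⟨k, hk⟩ else 1), ?_, ?_⟩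
    · have := H.constr_basis ℚ (fun k => if hk : k ∈ F then y ⟨k, hk⟩ else 1) i0
      rw [hi0] at this
      rw [this]
      simp [F]
    · intro i
      rw [Module.Basis.constr_basis]
      simp

lemma common_den {J : Type*} [Fintype J] (q : J → ℚ) :
    ∃ M : ℕ, 0 < M ∧ ∀ j, ∃ z : ℤ, (M : ℝ) * (q j : ℝ) = z := by
  classical
  refine ⟨∏ j, (q j).den, Finset.prod_pos fun j _ => (q j).den_pos, fun j => ?_⟩
  refine ⟨(∏ i ∈ Finset.univ.erase j, (q i).den : ℕ) * (q j).num, ?_⟩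
  rw [← Finset.mul_prod_erase _ _ (Finset.mem_univ j)]
  have : ((q j).den : ℚ) * q j = (q j).num := Rat.den_mul_eq_num (q j)
  have h : ((q j).den : ℝ) * q j = (q j).num := by exact_mod_cast this
  push_cast
  linear_combination (∏ i ∈ Finset.univ.erase j, ((q i).den : ℝ)) * h

lemma map_mem {s : ℕ} {V : AffineSubspace ℝ (Fin s → ℝ)} (hV : IsRationalAffine V)
    {v : Fin s → ℝ} (hv : v ∈ V) (φ : ℝ →ₗ[ℚ] ℝ) (hφ : φ 1 = 1) : (fun j => φ (v j)) ∈ V := by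
  have h : v ∈ affineSpan ℝ (Set.range (Subtype.val : {x : Fin s → ℝ | x ∈ V ∧ IsRationalPoint x} → _)) := by
    rw [Subtype.range_coe]
    have : v ∈ (V : Set (Fin s → ℝ)) := hv
    rw [hV] at this; exact this
  obtain ⟨S, w, hw, hvw⟩ := eq_affineCombination_of_mem_affineSpan h
  rw [Finset.affineCombination_eq_linear_combination _ _ _ hw] at hvw
  have h2 : (fun j => φ (v j)) = ∑ i ∈ S, φ (w i) • (i : Fin s → ℝ) := by
    funext j
    rw [hvw]
    simp only [Finset.sum_apply, Pi.smul_apply, smul_eq_mul, map_sum]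
    refine Finset.sum_congr rfl fun i _ => ?_
    obtain ⟨q, hq⟩ := i.2.2 j
    rw [hq, mul_comm, ← Rat.smul_def, map_smul, Rat.smul_def, mul_comm]
  have hw' : ∑ i ∈ S, φ (w i) = 1 := by rw [← map_sum, hw, hφ]
  rw [h2, ← Finset.affineCombination_eq_linear_combination _ _ _ hw']
  have := affineCombination_mem_affineSpan hw' (Subtype.val : {x : Fin s → ℝ | x ∈ V ∧ IsRationalPoint x} → _)
  rw [Subtype.range_coe] at this
  rw [← SetLike.mem_coe, hV]
  exact this

lemma dir_mem {s : ℕ} {ι : Type} [Fintype ι] (V : AffineSubspace ℝ (Fin s → ℝ))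
    (v : Fin s → ℝ)
    (hVmin : ∀ W : AffineSubspace ℝ (Fin s → ℝ), v ∈ W → IsRationalAffine W → V ≤ W)
    (r : Fin s → ℚ) (q : Fin s → ι → ℚ) (b : ι → ℝ)
    (hv : ∀ j, v j = r j + ∑ i, (q j i : ℝ) * b i)
    (e : Fin s → ℝ) (heV : e ∈ V.direction) :
    ∃ t : ι → ℝ, e = ∑ i, t i • (fun j => (q j i : ℝ)) := by
  let R : Fin s → ℝ := fun j => r j
  let Q : ι → Fin s → ℝ := fun i j => q j i
  let W := AffineSubspace.mk' R (Submodule.span ℝ (Set.range Q))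
  have hvW : v ∈ W := by
    rw [AffineSubspace.mem_mk']
    have : v -ᵥ R = ∑ i, b i • Q i := by
      funext j
      simp [R, Q, hv j, mul_comm]
    rw [this]
    exact Submodule.sum_mem _ fun i _ => Submodule.smul_mem _ _ (Submodule.subset_span ⟨i, rfl⟩)
  have hRW : R ∈ W := AffineSubspace.self_mem_mk' _ _
  have hWr : IsRationalAffine W := by
    set P := affineSpan ℝ {x : Fin s → ℝ | x ∈ W ∧ IsRationalPoint x} with hP
    have hRP : R ∈ P := subset_affineSpan _ _ ⟨hRW, fun j => ⟨r j, rfl⟩⟩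
    have hle : W ≤ P := by
      intro x hx
      have hx' := (AffineSubspace.mem_mk' ).mp hx
      have : Submodule.span ℝ (Set.range Q) ≤ P.direction := by
        rw [Submodule.span_le]
        rintro _ ⟨i, rfl⟩
        have h1 : Q i +ᵥ R ∈ P := by
          refine subset_affineSpan _ _ ⟨?_, fun j => ⟨q j i + r j, by simp [Q, R]⟩⟩
          rw [AffineSubspace.mem_mk', vadd_vsub]
          exact Submodule.subset_span ⟨i, rfl⟩
        have := AffineSubspace.vsub_mem_direction h1 hRP
        rwa [vadd_vsub] at this
      have := AffineSubspace.vadd_mem_of_mem_direction (this hx') hRP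
      rwa [vsub_vadd] at this
    have hge : P ≤ W := affineSpan_le.mpr fun x hx => hx.1
    unfold IsRationalAffine
    rw [← hP, le_antisymm hle hge]
  have := AffineSubspace.direction_le (hVmin W hvW hWr) heV
  rw [AffineSubspace.direction_mk', Submodule.mem_span_range_iff_exists_fun] at this
  obtain ⟨t, ht⟩ := this
  exact ⟨t, ht.symm⟩

lemma N_sum {s : ℕ} {ι : Type} (N : (Fin s → ℝ) → ℝ)
    (hNzero : ∀ x, N x = 0 ↔ x = 0)
    (hNadd : ∀ x y, N (x + y) ≤ N x + N y) (S : Finset ι) (f : ι → Fin s → ℝ) :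
    N (∑ i ∈ S, f i) ≤ ∑ i ∈ S, N (f i) := by
  classical
  induction S using Finset.induction_on with
  | empty => simp [(hNzero 0).mpr rfl]
  | insert i S hi ih =>
    rw [Finset.sum_insert hi, Finset.sum_insert hi]
    linarith [hNadd (f i) (∑ i ∈ S, f i)]

lemma N_dir {s : ℕ} (N : (Fin s → ℝ) → ℝ)
    (hNsmul : ∀ (t : ℝ) (x : Fin s → ℝ), N (t • x) = |t| * N x)
    (hNadd : ∀ x y, N (x + y) ≤ N x + N y) (e η : Fin s → ℝ) (he : 0 < N e)
    (hy : 0 < N (e + η)) :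
    N ((N (e + η))⁻¹ • (e + η) - (N e)⁻¹ • e) ≤ 2 * N η / N e := by
  have hneg : N (-η) = N η := by
    have := hNsmul (-1) η
    simpa using this
  have h1 : (N (e + η))⁻¹ • (e + η) - (N e)⁻¹ • e
      = ((N (e + η))⁻¹ - (N e)⁻¹) • (e + η) + (N e)⁻¹ • η := by
    module
  have h2 : |N e - N (e + η)| ≤ N η := by
    rw [abs_le]
    have h3 := hNadd e η
    have h4 := hNadd (e + η) (-η)
    rw [add_neg_cancel_right, hneg] at h4
    constructor <;> linarith
  have h5 : (N (e + η))⁻¹ - (N e)⁻¹ = (N e - N (e + η)) / (N (e + η) * N e) := by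
    field_simp
  rw [h1]
  refine (hNadd _ _).trans ?_
  rw [hNsmul, hNsmul, abs_of_pos (inv_pos.mpr he), h5, abs_div, abs_of_pos (mul_pos hy he)]
  have h6 : |N e - N (e + η)| / (N (e + η) * N e) * N (e + η) = |N e - N (e + η)| / N e := by
    field_simp
  rw [h6, inv_mul_eq_div, ← add_div]
  gcongr
  linarith

/-- Lemma 6.9 (`lem: vectordiufantu`): Diophantine approximation inside the rational envelope
`V` of `v`, with divisibility by `p₀`, approximation of the weights `aᵢ`, and an anisotropy
condition towards a prescribed direction `e` of `V`. The norm on `Fin k → ℝ` is the maximum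
norm, while `N` is an arbitrary norm on `ℝˢ`. -/
theorem stmt_9 (p₀ s k : ℕ) (hp₀ : 0 < p₀) (hs : 0 < s) (hk : 0 < k)
    (ε₀ : ℝ) (hε₀ : 0 < ε₀)
    (N : (Fin s → ℝ) → ℝ)
    (hNzero : ∀ x, N x = 0 ↔ x = 0)
    (hNsmul : ∀ (t : ℝ) (x : Fin s → ℝ), N (t • x) = |t| * N x)
    (hNadd : ∀ x y, N (x + y) ≤ N x + N y)
    (a : Fin k → ℝ) (ha : ∀ i, 0 < a i) (hsum : ∑ i, a i = 1)
    (v : Fin s → ℝ) (hv : ¬ IsRationalPoint v)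
    (V : AffineSubspace ℝ (Fin s → ℝ)) (hvV : v ∈ V) (hVrat : IsRationalAffine V)
    (hVmin : ∀ W : AffineSubspace ℝ (Fin s → ℝ), v ∈ W → IsRationalAffine W → V ≤ W)
    (e : Fin s → ℝ) (heV : e ∈ V.direction) (he0 : e ≠ 0) :
    ∃ (n₀ : ℕ) (v' : Fin s → ℝ) (a' : Fin k → ℝ), 0 < n₀ ∧
      p₀ ∣ n₀ ∧
      v' ∈ V ∧
      (∀ i, 0 < a' i) ∧ ∑ i, a' i = 1 ∧
      (∀ j, ∃ z : ℤ, (n₀ : ℝ) * v' j = (z : ℝ)) ∧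
      (∀ i, ∃ z : ℤ, (n₀ : ℝ) * a' i = (z : ℝ)) ∧
      N (v - v') < ε₀ / n₀ ∧ ‖a - a'‖ < ε₀ / n₀ ∧
      N ((N (v - v'))⁻¹ • (v - v') - (N e)⁻¹ • e) < ε₀ := by
  have hNneg : ∀ x, N (-x) = N x := fun x => by simpa using hNsmul (-1) x
  have hN0 : ∀ x, 0 ≤ N x := fun x => by
    have h := hNadd x (-x)
    rw [add_neg_cancel, (hNzero 0).mpr rfl, hNneg] at h
    linarith
  have hNe : 0 < N e := lt_of_le_of_ne (hN0 e) fun h => he0 ((hNzero e).mp h.symm)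
  -- the rational structure
  obtain ⟨ι, _, b, c0, c, hf, hφ⟩ := rat_family (Sum.elim v a)
  obtain ⟨M, hM, hMz⟩ := common_den
    (Sum.elim c0 (fun x : (Fin s ⊕ Fin k) × ι => c x.1 x.2))
  have hM0 : ∀ l, ∃ z : ℤ, (M : ℝ) * c0 l = z := fun l => hMz (Sum.inl l)
  have hM1 : ∀ l i, ∃ z : ℤ, (M : ℝ) * c l i = z := fun l i => hMz (Sum.inr (l, i))
  choose m0 hm0 using hM0
  choose m1 hm1 using hM1
  obtain ⟨t, ht⟩ := dir_mem V v hVmin (fun j => c0 (Sum.inl j)) (fun j => c (Sum.inl j)) b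
    (fun j => hf (Sum.inl j)) e heV
  have hind : ∀ (w : ι → ℤ) (z : ℤ), ∑ i, (w i : ℝ) * b i = z → w = 0 := by
    classical
    intro w z hw
    have key : ∀ y : ι → ℝ, ∑ i, (w i : ℝ) * y i = z := by
      intro y
      obtain ⟨φ, h1, h2⟩ := hφ y
      have h3 : φ (∑ i, (w i : ℝ) * b i) = φ ((z : ℚ) • (1 : ℝ)) := by
        rw [hw]; simp [Rat.smul_def]
      rw [map_smul, h1, map_sum] at h3
      have h4 : ∀ i, φ ((w i : ℝ) * b i) = (w i : ℝ) * y i := by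
        intro i
        have : (w i : ℝ) * b i = ((w i : ℚ)) • b i := by simp [Rat.smul_def]
        rw [this, map_smul, h2, Rat.smul_def]; simp
      simp_rw [h4] at h3
      rw [h3]; simp [Rat.smul_def]
    funext i
    have h0 := key 0
    have h1 := key (Pi.single i 1)
    simp only [Pi.zero_apply, mul_zero, Finset.sum_const_zero] at h0
    rw [← h0] at h1
    simpa [Pi.single_apply] using h1
  -- the constants
  obtain ⟨ε, hε, hεε₀, hεa⟩ : ∃ ε : ℝ, 0 < ε ∧ ε ≤ ε₀ ∧ ∀ i, ε ≤ a i := by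
    haveI : Nonempty (Fin k) := ⟨⟨0, hk⟩⟩
    obtain ⟨i0, hi0⟩ := Finite.exists_min a
    exact ⟨min ε₀ (a i0), lt_min hε₀ (ha i0), min_le_left _ _,
      fun i => (min_le_right _ _).trans (hi0 i)⟩
  set Q : ι → Fin s → ℝ := fun i j => (c (Sum.inl j) i : ℝ) with hQ
  set C : ℝ := ∑ i, N (Q i) with hC
  have hC0 : 0 ≤ C := Finset.sum_nonneg fun i _ => hN0 _
  set A : ℝ := ∑ l : Fin k, ∑ i, |(c (Sum.inr l) i : ℝ)| * (|t i| + 1) with hA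
  have hA0 : 0 ≤ A := Finset.sum_nonneg fun l _ => Finset.sum_nonneg fun i _ => by positivity
  obtain ⟨κ, hκ, hκ1, hκC⟩ : ∃ κ : ℝ, 0 < κ ∧ κ ≤ 1 ∧ κ * C ≤ N e * min 1 ε / 4 := by
    have hm : 0 < N e * min 1 ε / 4 := by positivity
    refine ⟨min 1 ((N e * min 1 ε / 4) / (C + 1)), by positivity, min_le_left _ _, ?_⟩
    calc _ ≤ ((N e * min 1 ε / 4) / (C + 1)) * (C + 1) := by
          gcongr
          · exact min_le_right _ _
          · linarith
      _ = _ := by field_simp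
  set P : ℝ := (p₀ : ℝ) * M with hP
  have hP0 : 0 < P := by positivity
  obtain ⟨τ, hτ, hτP⟩ : ∃ τ : ℝ, 0 < τ ∧ P * (τ * (2 * N e + A + 1)) = ε / 2 := by
    have : 0 < 2 * N e + A + 1 := by positivity
    exact ⟨ε / (2 * P * (2 * N e + A + 1)), by positivity, by field_simp⟩
  obtain ⟨n, hn, z, hz⟩ := kronecker b (fun i => τ * t i) hind (τ * κ) (by positivity)
  have hn' : (0 : ℝ) < n := by exact_mod_cast hn
  obtain ⟨φ, hφ1, hφb⟩ := hφ (fun i => (z i : ℝ) / n)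
  set x : ι → ℝ := fun i => ((n : ℝ) * b i - τ * t i - z i) / τ with hx
  have hxκ : ∀ i, |x i| ≤ κ := by
    intro i
    rw [hx]
    simp only
    rw [abs_div, abs_of_pos hτ, div_le_iff₀ hτ]
    linarith [hz i]
  have hφf : ∀ l, φ (Sum.elim v a l) = c0 l + ∑ i, (c l i : ℝ) * (z i / n) := by
    intro l
    rw [hf l, map_add, map_sum]
    have h1 : φ (c0 l : ℝ) = c0 l := by
      have : (c0 l : ℝ) = c0 l • (1 : ℝ) := by simp [Rat.smul_def]
      rw [this, map_smul, hφ1]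
    rw [h1]
    congr 1
    refine Finset.sum_congr rfl fun i _ => ?_
    rw [← Rat.smul_def, map_smul, hφb, Rat.smul_def]
  have hdiff : ∀ l, Sum.elim v a l - φ (Sum.elim v a l)
      = τ / n * ∑ i, (c l i : ℝ) * (t i + x i) := by
    intro l
    rw [hφf l, hf l, add_sub_add_left_eq_sub, ← Finset.sum_sub_distrib, Finset.mul_sum]
    refine Finset.sum_congr rfl fun i _ => ?_
    rw [hx]
    field_simp
    ring
  have hint : ∀ l, ∃ w : ℤ, ((p₀ * M * n : ℕ) : ℝ) * φ (Sum.elim v a l) = w := by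
    intro l
    refine ⟨p₀ * (m0 l * n + ∑ i, m1 l i * z i), ?_⟩
    rw [hφf l]
    push_cast
    have h1 : ((p₀ : ℝ) * M * n) * (c0 l + ∑ i, (c l i : ℝ) * (z i / n))
        = p₀ * ((M * c0 l) * n + ∑ i, ((M : ℝ) * (c l i : ℝ)) * (z i : ℝ)) := by
      rw [mul_add, mul_add, Finset.mul_sum, Finset.mul_sum]
      congr 1
      · ring
      · refine Finset.sum_congr rfl fun i _ => ?_
        field_simp
    rw [h1, hm0]
    simp_rw [hm1]
  set η : Fin s → ℝ := ∑ i, x i • Q i with hη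
  have hvv : v - (fun j => φ (v j)) = (τ / n) • (e + η) := by
    funext j
    have := hdiff (Sum.inl j)
    simp only [Sum.elim_inl] at this
    simp only [Pi.sub_apply, this, Pi.smul_apply, smul_eq_mul, Pi.add_apply]
    rw [ht, hη]
    simp only [Finset.sum_apply, Pi.smul_apply, smul_eq_mul, ← Finset.sum_add_distrib, hQ]
    congr 1
    refine Finset.sum_congr rfl fun i _ => ?_
    ring
  have hηC : N η ≤ κ * C := by
    refine (N_sum N hNzero hNadd _ _).trans ?_
    rw [hC, Finset.mul_sum]
    refine Finset.sum_le_sum fun i _ => ?_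
    rw [hNsmul]
    exact mul_le_mul_of_nonneg_right (hxκ i) (hN0 _)
  have hη4 : N η ≤ N e / 4 := by
    have : N e * min 1 ε ≤ N e * 1 := by gcongr; exact min_le_left _ _
    linarith
  have hηε : N η ≤ N e * ε / 4 := by
    have : N e * min 1 ε ≤ N e * ε := by gcongr; exact min_le_right _ _
    linarith
  have hy : 0 < N (e + η) := by
    have h4 := hNadd (e + η) (-η)
    rw [add_neg_cancel_right, hNneg] at h4
    linarith
  have hy2 : N (e + η) ≤ 2 * N e := by linarith [hNadd e η]
  have hτn : 0 < τ / n := by positivity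
  have hPn : ((p₀ * M * n : ℕ) : ℝ) = P * n := by push_cast; rw [hP]
  have hbound : ∀ B : ℝ, B ≤ 2 * N e + A → τ / n * B < ε / ((p₀ * M * n : ℕ) : ℝ) := by
    intro B hB
    rw [hPn, lt_div_iff₀ (by positivity)]
    calc τ / n * B * (P * n) = P * (τ * B) := by field_simp
      _ ≤ P * (τ * (2 * N e + A + 1)) := by gcongr; linarith
      _ < ε := by rw [hτP]; linarith
  have hn1 : (1 : ℝ) ≤ ((p₀ * M * n : ℕ) : ℝ) := by
    exact_mod_cast Nat.succ_le_of_lt (by positivity)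
  have hεdiv : ε / ((p₀ * M * n : ℕ) : ℝ) ≤ ε₀ / ((p₀ * M * n : ℕ) : ℝ) := by gcongr
  have haa : ∀ l, |a l - φ (a l)| < ε / ((p₀ * M * n : ℕ) : ℝ) := by
    intro l
    have := hdiff (Sum.inr l)
    simp only [Sum.elim_inr] at this
    rw [this, abs_mul, abs_of_pos hτn]
    apply hbound
    have h1 : |∑ i, (c (Sum.inr l) i : ℝ) * (t i + x i)|
        ≤ ∑ i, |(c (Sum.inr l) i : ℝ)| * (|t i| + 1) := by
      refine (Finset.abs_sum_le_sum_abs _ _).trans (Finset.sum_le_sum fun i _ => ?_)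
      rw [abs_mul]
      gcongr
      exact (abs_add_le _ _).trans (by linarith [hxκ i])
    have h2 : ∑ i, |(c (Sum.inr l) i : ℝ)| * (|t i| + 1) ≤ A := by
      rw [hA]
      exact Finset.single_le_sum
        (f := fun l : Fin k => ∑ i, |(c (Sum.inr l) i : ℝ)| * (|t i| + 1))
        (fun l _ => Finset.sum_nonneg fun i _ => by positivity) (Finset.mem_univ l)
    linarith
  refine ⟨p₀ * M * n, fun j => φ (v j), fun l => φ (a l), by positivity,
    ⟨M * n, by ring⟩, map_mem hVrat hvV φ hφ1, ?_, ?_, fun j => hint (Sum.inl j),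
    fun l => hint (Sum.inr l), ?_, ?_, ?_⟩
  · intro l
    have h1 := (haa l).trans_le (div_le_self hε.le hn1)
    have h2 := (abs_lt.mp h1).2
    linarith [hεa l]
  · rw [← map_sum, hsum, hφ1]
  · rw [hvv, hNsmul, abs_of_pos hτn]
    exact (hbound _ (by linarith)).trans_le hεdiv
  · rw [pi_norm_lt_iff (by positivity)]
    intro l
    exact (haa l).trans_le hεdiv
  · rw [hvv, hNsmul, abs_of_pos hτn, smul_smul]
    have h1 : (τ / n * N (e + η))⁻¹ * (τ / n) = (N (e + η))⁻¹ := by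
      field_simp
    rw [h1]
    refine (N_dir N hNsmul hNadd e η hNe hy).trans_lt ?_
    rw [div_lt_iff₀ hNe]
    have : 0 < N e * ε := by positivity
    nlinarith
end
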